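/- Let s ∈ [3/4, 1). There exists a constant C > 0 depending only on s such that for every T ≥ 1 and every measurable g : ℝ³ → ℂ satisfying |g(k)| ≤ T almost everywhere and ∫_{ℝ³} |k|^(2(1−s)) |g(k)|² dk ≤ T^(3−5/(2s)), one has ∫_{ℝ³} |g(k)|² dk ≤ C · T^(2−3/(2s)). -/

import Mathlib

open MeasureTheory Real

/-- Splitting a square integral at radius `R`: below `R` the pointwise bound `‖g‖ ≤ T` is used,
above `R` the weight `‖k‖ ^ a` is at least `R ^ a`. -/
lemma lintegral_sq_norm_le_ball_add_weighted {E F : Type*} [NormedAddCommGroup E]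
    [MeasurableSpace E] [OpensMeasurableSpace E] [NormedAddCommGroup F] (μ : Measure E)
    {g : E → F} {a R T : ℝ} (ha : 0 ≤ a) (hR : 0 < R)
    (hg : ∀ᵐ k ∂μ, ‖g k‖ ≤ T) :
    ∫⁻ k, ENNReal.ofReal (‖g k‖ ^ 2) ∂μ ≤
      ENNReal.ofReal (T ^ 2) * μ (Metric.ball 0 R) +
        ENNReal.ofReal (R ^ (-a)) * ∫⁻ k, ENNReal.ofReal (‖k‖ ^ a * ‖g k‖ ^ 2) ∂μ := by
  rw [← lintegral_const_mul' _ _ ENNReal.ofReal_ne_top,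
    ← lintegral_indicator_const Metric.isOpen_ball.measurableSet,
    ← lintegral_add_left (measurable_const.indicator Metric.isOpen_ball.measurableSet)]
  refine lintegral_mono_ae ?_
  filter_upwards [hg] with k hk
  by_cases h : k ∈ Metric.ball (0 : E) R
  · rw [Set.indicator_of_mem h]
    exact le_add_right (ENNReal.ofReal_le_ofReal (by gcongr))
  · rw [Set.indicator_of_notMem h, zero_add, ← ENNReal.ofReal_mul (by positivity)]
    refine ENNReal.ofReal_le_ofReal ?_
    have hRk : R ≤ ‖k‖ := by simpa using h
    have h1 : 1 ≤ R ^ (-a) * ‖k‖ ^ a := by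
      calc (1 : ℝ) = R ^ (-a) * R ^ a := by rw [← rpow_add hR]; simp
        _ ≤ R ^ (-a) * ‖k‖ ^ a := by gcongr
    rw [← mul_assoc]
    exact le_mul_of_one_le_left (by positivity) h1

/-- Concrete frequency-splitting optimization: for `s ∈ [3/4, 1)` there is `C = C(s) > 0`
such that for every `T ≥ 1` and measurable `g` with `|g| ≤ T` a.e. and
`∫ |k|^(2(1−s))|g|² ≤ T^(3−5/(2s))`, one has `∫ |g|² ≤ C·T^(2−3/(2s))`. -/
theorem frequency_splitting_concrete (s : ℝ) (hs : s ∈ Set.Ico (3/4 : ℝ) 1) :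
    ∃ C > (0:ℝ), ∀ T ≥ (1:ℝ), ∀ g : EuclideanSpace ℝ (Fin 3) → ℂ, Measurable g →
      (∀ᵐ k ∂(volume : Measure (EuclideanSpace ℝ (Fin 3))), ‖g k‖ ≤ T) →
      (∫⁻ k, ENNReal.ofReal (‖k‖ ^ (2*(1-s)) * ‖g k‖ ^ 2)
        ≤ ENNReal.ofReal (T ^ (3 - 5/(2*s)))) →
      ∫⁻ k, ENNReal.ofReal (‖g k‖ ^ 2) ≤ ENNReal.ofReal (C * T ^ (2 - 3/(2*s))) := by
  obtain ⟨hs₁, hs₂⟩ := hs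
  have hs₀ : s ≠ 0 := by linarith
  set B : Set (EuclideanSpace ℝ (Fin 3)) := Metric.ball 0 1
  set V : ℝ := (volume B).toReal
  have hV : volume B = ENNReal.ofReal V := (ENNReal.ofReal_toReal measure_ball_lt_top.ne).symm
  have hV₀ : 0 ≤ V := ENNReal.toReal_nonneg
  refine ⟨V + 1, by positivity, fun T hT g _ hg hw => ?_⟩
  have hT₀ : 0 < T := by linarith
  have hR : 0 < T ^ (-(1 / (2 * s))) := by positivity
  have hlow : T ^ 2 * ((T ^ (-(1 / (2 * s)))) ^ 3 * V) = V * T ^ (2 - 3 / (2 * s)) := by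
    rw [← rpow_natCast, ← rpow_natCast, ← rpow_mul hT₀.le, ← mul_assoc, ← rpow_add hT₀, mul_comm]
    congr 2
    push_cast
    ring
  have hhigh : (T ^ (-(1 / (2 * s)))) ^ (-(2 * (1 - s))) * T ^ (3 - 5 / (2 * s)) =
      T ^ (2 - 3 / (2 * s)) := by
    rw [← rpow_mul hT₀.le, ← rpow_add hT₀]
    congr 1
    field_simp
    ring
  calc ∫⁻ k, ENNReal.ofReal (‖g k‖ ^ 2)
      ≤ _ := lintegral_sq_norm_le_ball_add_weighted volume
        (by linarith : 0 ≤ 2 * (1 - s)) hR hg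
    _ ≤ ENNReal.ofReal (T ^ 2) * (ENNReal.ofReal ((T ^ (-(1 / (2 * s)))) ^ 3) * ENNReal.ofReal V) +
        ENNReal.ofReal ((T ^ (-(1 / (2 * s)))) ^ (-(2 * (1 - s)))) *
          ENNReal.ofReal (T ^ (3 - 5 / (2 * s))) := by
      rw [Measure.addHaar_ball _ _ hR.le, hV, finrank_euclideanSpace_fin]
      gcongr
    _ = ENNReal.ofReal ((V + 1) * T ^ (2 - 3 / (2 * s))) := by
      rw [← ENNReal.ofReal_mul (by positivity), ← ENNReal.ofReal_mul (by positivity),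
        ← ENNReal.ofReal_mul (by positivity), hlow, hhigh,
        ← ENNReal.ofReal_add (by positivity) (by positivity), add_one_mul]
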